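/- arXiv:2109.13169 — 2 statements merged into one kernel-verified Lean document; each statement's English description precedes it below -/
import Mathlib

section
/- Variance local consistency of the scheme (A.2): the variance of the one-step spatial increment satisfies |Var(ΔX) − σ²·Δt| ≤ (|b−u| + (b−u)²)·h·Δt; in particular, with b, σ, u and the switching rates held fixed, (Var(ΔX) − σ²·Δt)/Δt → 0 as h → 0⁺, i.e. Var(ΔX) = σ²·Δt + o(Δt). -/
open Filter

/-- Variance local consistency of the scheme (A.2):
|Var(ΔX) − σ²·Δt| ≤ (|b−u| + (b−u)²)·h·Δt, and with b, σ, u, and the switching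
rates fixed, (Var(ΔX) − σ²·Δt)/Δt → 0 as h → 0⁺, i.e. Var(ΔX) = σ²·Δt + o(Δt). -/
theorem stmt_3 (b σ u : ℝ) (m0 : ℕ) (k : Fin m0) (q : Fin m0 → Fin m0 → ℝ)
    (hq : ∀ l, l ≠ k → 0 ≤ q k l)
    (hqkk : q k k = -∑ l ∈ Finset.univ.erase k, q k l)
    (Qh Δt pplus pminus Var : ℝ → ℝ)
    (hQ : ∀ h : ℝ, Qh h = σ ^ 2 + h * |b - u| - h ^ 2 * q k k + h)
    (hΔt : ∀ h : ℝ, Δt h = h ^ 2 / Qh h)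
    (hpp : ∀ h : ℝ, pplus h = (σ ^ 2 / 2 + h * max (b - u) 0) / Qh h)
    (hpm : ∀ h : ℝ, pminus h = (σ ^ 2 / 2 + h * max (-(b - u)) 0) / Qh h)
    (hVar : ∀ h : ℝ,
      Var h = h ^ 2 * (pplus h + pminus h) - (h * pplus h - h * pminus h) ^ 2) :
    (∀ h : ℝ, 0 < h →
      |Var h - σ ^ 2 * Δt h| ≤ (|b - u| + (b - u) ^ 2) * h * Δt h) ∧
    Tendsto (fun h : ℝ => (Var h - σ ^ 2 * Δt h) / Δt h)
      (nhdsWithin 0 (Set.Ioi 0)) (nhds 0) := by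
  have hqk : q k k ≤ 0 := by
    rw [hqkk, neg_nonpos]
    exact Finset.sum_nonneg (fun l hl => hq l (Finset.ne_of_mem_erase hl))
  have hQge : ∀ h : ℝ, 0 < h → h ≤ Qh h := by
    intro h hh
    rw [hQ]
    have h1 : 0 ≤ h * |b - u| := by positivity
    have h2 : 0 ≤ h ^ 2 * (-q k k) := mul_nonneg (by positivity) (by linarith)
    nlinarith [sq_nonneg σ]
  have hΔpos : ∀ h : ℝ, 0 < h → 0 < Δt h := by
    intro h hh
    have := lt_of_lt_of_le hh (hQge h hh)
    rw [hΔt]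
    positivity
  have hΔle : ∀ h : ℝ, 0 < h → Δt h ≤ h := by
    intro h hh
    have hQp := lt_of_lt_of_le hh (hQge h hh)
    rw [hΔt, div_le_iff₀ hQp]
    nlinarith [hQge h hh]
  have hadd : max (b - u) 0 + max (-(b - u)) 0 = |b - u| := by
    rcases le_total 0 (b - u) with h | h
    · rw [max_eq_left h, max_eq_right (by linarith), abs_of_nonneg h]; ring
    · rw [max_eq_right h, max_eq_left (by linarith), abs_of_nonpos h]; ring
  have hsub : max (b - u) 0 - max (-(b - u)) 0 = b - u := by
    rcases le_total 0 (b - u) with h | h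
    · rw [max_eq_left h, max_eq_right (by linarith)]; ring
    · rw [max_eq_right h, max_eq_left (by linarith)]; ring
  have key : ∀ h : ℝ, Var h - σ ^ 2 * Δt h
      = (h * |b - u| - Δt h * (b - u) ^ 2) * Δt h := by
    intro h
    rw [hVar, hpp, hpm, hΔt]
    generalize max (b - u) 0 = P at hadd hsub ⊢
    generalize max (-(b - u)) 0 = N at hadd hsub ⊢
    rw [← hadd, ← hsub]
    ring
  have bound : ∀ h : ℝ, 0 < h →
      |h * |b - u| - Δt h * (b - u) ^ 2| ≤ (|b - u| + (b - u) ^ 2) * h := by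
    intro h hh
    have h1 : 0 ≤ h * |b - u| := by positivity
    have h2 : 0 ≤ Δt h * (b - u) ^ 2 := mul_nonneg (hΔpos h hh).le (sq_nonneg _)
    have h3 : Δt h * (b - u) ^ 2 ≤ h * (b - u) ^ 2 :=
      mul_le_mul_of_nonneg_right (hΔle h hh) (sq_nonneg _)
    rw [abs_le]
    constructor <;> nlinarith
  refine ⟨?_, ?_⟩
  · intro h hh
    rw [key, abs_mul, abs_of_pos (hΔpos h hh)]
    exact mul_le_mul_of_nonneg_right (bound h hh) (hΔpos h hh).le
  · have hlim : Tendsto (fun h : ℝ => (|b - u| + (b - u) ^ 2) * h)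
        (nhdsWithin 0 (Set.Ioi 0)) (nhds 0) := by
      have hc : Continuous (fun h : ℝ => (|b - u| + (b - u) ^ 2) * h) := by fun_prop
      have := hc.tendsto 0
      simp only [mul_zero] at this
      exact this.mono_left nhdsWithin_le_nhds
    refine squeeze_zero_norm' ?_ hlim
    filter_upwards [self_mem_nhdsWithin] with h hh
    rw [key, mul_div_cancel_right₀ _ (hΔpos h hh).ne', Real.norm_eq_abs]
    exact bound h hh
end

section
/- Second-moment local consistency of the variable-effort scheme (AA.2): the one-step spatial increment satisfies exactly E[ΔX²] = (σ² + h|b − u·x|)·Δt, and hence Var(ΔX) = σ²·Δt + h|b−u·x|·Δt − (b−u·x)²·Δt², so that, with b, σ, u, x and the switching rates fixed, Var(ΔX) = σ²·Δt + o(Δt) as h → 0⁺. -/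
open Filter

/-- Second-moment local consistency of the variable-effort scheme
(AA.2): E[ΔX²] = (σ² + h|b − u·x|)·Δt exactly, hence
Var(ΔX) = σ²·Δt + h|b−u·x|·Δt − (b−u·x)²·Δt², so that, with b, σ, u, x and the
switching rates fixed, Var(ΔX) = σ²·Δt + o(Δt) as h → 0⁺. -/
theorem stmt_7 (b σ u x : ℝ) (hx : 0 ≤ x) (m0 : ℕ) (k : Fin m0)
    (q : Fin m0 → Fin m0 → ℝ)
    (hq : ∀ l, l ≠ k → 0 ≤ q k l)
    (hqkk : q k k = -∑ l ∈ Finset.univ.erase k, q k l)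
    (Qh Δt pplus pminus EΔX2 Var : ℝ → ℝ)
    (hQ : ∀ h : ℝ, Qh h = σ ^ 2 + h * |b - u * x| - h ^ 2 * q k k + h)
    (hΔt : ∀ h : ℝ, Δt h = h ^ 2 / Qh h)
    (hpp : ∀ h : ℝ, pplus h = (σ ^ 2 / 2 + h * max (b - u * x) 0) / Qh h)
    (hpm : ∀ h : ℝ, pminus h = (σ ^ 2 / 2 + h * max (-(b - u * x)) 0) / Qh h)
    (hE2 : ∀ h : ℝ, EΔX2 h = h ^ 2 * (pplus h + pminus h))
    (hVar : ∀ h : ℝ, Var h = EΔX2 h - (h * pplus h - h * pminus h) ^ 2) :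
    (∀ h : ℝ, 0 < h → EΔX2 h = (σ ^ 2 + h * |b - u * x|) * Δt h) ∧
    (∀ h : ℝ, 0 < h →
      Var h = σ ^ 2 * Δt h + h * |b - u * x| * Δt h - (b - u * x) ^ 2 * Δt h ^ 2) ∧
    Tendsto (fun h : ℝ => (Var h - σ ^ 2 * Δt h) / Δt h)
      (nhdsWithin 0 (Set.Ioi 0)) (nhds 0) := by
  have hkk : q k k ≤ 0 := by
    rw [hqkk]
    have : 0 ≤ ∑ l ∈ Finset.univ.erase k, q k l :=
      Finset.sum_nonneg fun l hl => hq l (Finset.ne_of_mem_erase hl)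
    linarith
  generalize b - u * x = c at *
  have hs : max c 0 + max (-c) 0 = |c| := by
    rcases le_total 0 c with h | h
    · rw [max_eq_left h, max_eq_right (by linarith), abs_of_nonneg h]; ring
    · rw [max_eq_right h, max_eq_left (by linarith), abs_of_nonpos h]; ring
  have hd : max c 0 - max (-c) 0 = c := by
    rcases le_total 0 c with h | h
    · rw [max_eq_left h, max_eq_right (by linarith)]; ring
    · rw [max_eq_right h, max_eq_left (by linarith)]; ring
  have hQge : ∀ h : ℝ, 0 < h → h ≤ Qh h := by
    intro h hh
    rw [hQ]
    have h1 : 0 ≤ h * |c| := by positivity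
    have h2 : 0 ≤ h ^ 2 * (-q k k) := mul_nonneg (by positivity) (by linarith)
    nlinarith [sq_nonneg σ]
  have hA : ∀ h : ℝ, EΔX2 h = (σ ^ 2 + h * |c|) * Δt h := by
    intro h
    rw [hE2, hpp, hpm, hΔt, ← hs]
    ring
  have hB : ∀ h : ℝ,
      Var h = σ ^ 2 * Δt h + h * |c| * Δt h - c ^ 2 * Δt h ^ 2 := by
    intro h
    have e : h * pplus h - h * pminus h = c * Δt h := by
      rw [hpp, hpm, hΔt]
      nth_rewrite 3 [← hd]
      ring
    rw [hVar, e, hA]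
    ring
  refine ⟨fun h _ => hA h, fun h _ => hB h, ?_⟩
  have hlim : Tendsto (fun h : ℝ => h * (|c| + c ^ 2))
      (nhdsWithin 0 (Set.Ioi 0)) (nhds 0) := by
    have : Tendsto (fun h : ℝ => h * (|c| + c ^ 2)) (nhds 0) (nhds (0 * (|c| + c ^ 2))) :=
      (continuous_id.mul continuous_const).tendsto 0
    rw [zero_mul] at this
    exact this.mono_left nhdsWithin_le_nhds
  refine squeeze_zero_norm' ?_ hlim
  filter_upwards [self_mem_nhdsWithin] with h hh
  have hh : 0 < h := hh
  have hQp : 0 < Qh h := lt_of_lt_of_le hh (hQge h hh)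
  have hp : 0 < Δt h := by rw [hΔt]; positivity
  have hle : Δt h ≤ h := by
    rw [hΔt, div_le_iff₀ hQp]
    nlinarith [hQge h hh]
  have e : (Var h - σ ^ 2 * Δt h) / Δt h = h * |c| - c ^ 2 * Δt h := by
    rw [hB]
    field_simp
    ring
  rw [e, Real.norm_eq_abs, abs_le]
  have h1 : 0 ≤ h * |c| := by positivity
  have h2 : 0 ≤ c ^ 2 * Δt h := by positivity
  have h3 : c ^ 2 * Δt h ≤ c ^ 2 * h := by gcongr
  constructor <;> nlinarith
end
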